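/- First moment of a Gaussian over an orthant-type region: for positive definite Σ ∈ ℝ^{K×K} and a ∈ ℝ^K, ∫_{[a,∞)} z φ(z; 0, Σ) dz = Σ F(a), where the k-th entry of F(a) is φ([a]_k; 0, Σ_{kk}) times the probability that a Gaussian with mean Σ_{-k,k} Σ_{kk}^{-1} a_k and covariance Σ_{-k,-k} - Σ_{-k,k} Σ_{kk}^{-1} Σ_{k,-k} lies in [a_{-k}, ∞). -/

import Mathlib

open Matrix MeasureTheory

/-- Multivariate Gaussian density with mean `m` and covariance `S`, evaluated at `x`. -/
noncomputable def gaussD {ι : Type} [Fintype ι] [DecidableEq ι]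
    (S : Matrix ι ι ℝ) (m x : ι → ℝ) : ℝ :=
  (Real.sqrt ((2 * Real.pi) ^ (Fintype.card ι) * S.det))⁻¹ *
    Real.exp (-(1 / 2) * ((x - m) ⬝ᵥ (S⁻¹ *ᵥ (x - m))))

def glueAt {K : ℕ} (k : Fin K) (t : ℝ) (u : {j : Fin K // j ≠ k} → ℝ) : Fin K → ℝ :=
  fun i => if h : i = k then t else u ⟨i, h⟩

lemma glueAt_self {K : ℕ} (k : Fin K) (t : ℝ) (u : {j : Fin K // j ≠ k} → ℝ) :
    glueAt k t u k = t := by simp [glueAt]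

lemma glueAt_ne {K : ℕ} (k : Fin K) (t : ℝ) (u : {j : Fin K // j ≠ k} → ℝ)
    (j : {j : Fin K // j ≠ k}) :
    glueAt k t u j.1 = u j := by
  have := j.2
  simp [glueAt, this]

lemma exists_splitEquiv {K : ℕ} (k : Fin K) :
    ∃ e : (ℝ × ({j : Fin K // j ≠ k} → ℝ)) ≃ᵐ (Fin K → ℝ),
      MeasurePreserving e (volume.prod volume) volume ∧ ∀ t u, e (t, u) = glueAt k t u := by
  have h1 : MeasurePreserving
      (MeasurableEquiv.piEquivPiSubtypeProd (fun _ : Fin K => ℝ) (fun i => i = k)) volume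
      ((volume : Measure ({j : Fin K // j = k} → ℝ)).prod
        (volume : Measure ({j : Fin K // ¬ j = k} → ℝ))) := by
    have h0 := volume_preserving_piEquivPiSubtypeProd (fun _ : Fin K => ℝ) (fun i => i = k)
    rw [Measure.volume_eq_prod] at h0
    convert h0 using 3 <;> congr! 1
  have h2 : MeasurePreserving (MeasurableEquiv.funUnique {i : Fin K // i = k} ℝ)
      volume volume := by
    convert volume_preserving_funUnique {i : Fin K // i = k} ℝ
  have h3 := h2.prod (MeasurePreserving.id (volume : Measure ({j : Fin K // ¬ j = k} → ℝ)))
  let e := (MeasurableEquiv.piEquivPiSubtypeProd (fun _ : Fin K => ℝ) (fun i => i = k)).trans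
    ((MeasurableEquiv.funUnique {i : Fin K // i = k} ℝ).prodCongr
      (MeasurableEquiv.refl ({j : Fin K // ¬ j = k} → ℝ)))
  have he : MeasurePreserving e volume (volume.prod volume) := h3.comp h1
  refine ⟨e.symm, he.symm e, fun t u => ?_⟩
  rw [MeasurableEquiv.symm_apply_eq]
  refine Prod.ext ?_ ?_
  · exact (glueAt_self k t u).symm
  · funext j
    exact (glueAt_ne k t u j).symm

lemma ibp {K : ℕ} (k : Fin K) (a : Fin K → ℝ) (f f' : (Fin K → ℝ) → ℝ)
    (hf : Integrable f) (hf' : Integrable f')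
    (hd : ∀ u t, HasDerivAt (fun t => f (glueAt k t u)) (f' (glueAt k t u)) t) :
    ∫ z in {z : Fin K → ℝ | ∀ k, a k ≤ z k}, f' z =
      - ∫ u in {u : {j : Fin K // j ≠ k} → ℝ | ∀ j, a j.1 ≤ u j}, f (glueAt k (a k) u) := by
  obtain ⟨e, he, hg⟩ := exists_splitEquiv k
  have hfi : Integrable (fun p => f (e p)) (volume.prod volume) :=
    (he.integrable_comp_emb e.measurableEmbedding).2 hf
  have hfi' : Integrable (fun p => f' (e p)) (volume.prod volume) :=
    (he.integrable_comp_emb e.measurableEmbedding).2 hf'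
  rw [← he.setIntegral_preimage_emb e.measurableEmbedding]
  have hs : e ⁻¹' {z : Fin K → ℝ | ∀ k, a k ≤ z k} =
      Set.Ici (a k) ×ˢ {u : {j : Fin K // j ≠ k} → ℝ | ∀ j, a j.1 ≤ u j} := by
    ext ⟨t, u⟩
    simp only [Set.mem_preimage, hg, Set.mem_ofPred_eq, Set.mem_prod, Set.mem_Ici]
    constructor
    · intro h
      exact ⟨by simpa [glueAt_self] using h k, fun j => by simpa [glueAt_ne] using h j.1⟩
    · rintro ⟨h1, h2⟩ i
      by_cases hi : i = k
      · subst hi; simpa [glueAt_self] using h1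
      · have := h2 ⟨i, hi⟩
        rwa [← glueAt_ne k t u ⟨i, hi⟩] at this
  rw [hs, ← Measure.prod_restrict, integral_prod_symm, ← integral_neg]
  · refine integral_congr_ae (ae_restrict_of_ae ?_)
    filter_upwards [hfi.prod_left_ae, hfi'.prod_left_ae] with u h1 h2
    simp only [hg] at h1 h2 ⊢
    rw [integral_Ici_eq_integral_Ioi,
      integral_Ioi_of_hasDerivAt_of_tendsto (m := 0) (f := fun t => f (glueAt k t u))
        (hd u _).continuousAt.continuousWithinAt
        (fun x _ => hd u x) h2.integrableOn
        (tendsto_zero_of_hasDerivAt_of_integrableOn_Ioi (a := 0) (fun x _ => hd u x)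
          h2.integrableOn h1.integrableOn)]
    simp
  · rw [Measure.prod_restrict]
    exact hfi'.integrableOn

lemma coord_bound {n : Type} [Fintype n] [DecidableEq n] (S : Matrix n n ℝ) (hS : S.PosDef)
    (z : n → ℝ) (i : n) : z i ^ 2 ≤ S i i * (z ⬝ᵥ (S⁻¹ *ᵥ z)) := by
  have hdet : IsUnit S.det := hS.det_pos.ne'.isUnit
  have hii : 0 < S i i := hS.diag_pos
  have hPt : S⁻¹ᵀ = S⁻¹ := by simpa using hS.inv.isHermitian.eq
  have hPS : S⁻¹ *ᵥ (S *ᵥ Pi.single i 1) = Pi.single i 1 := by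
    rw [mulVec_mulVec, nonsing_inv_mul _ hdet, one_mulVec]
  have hsymm : (S *ᵥ Pi.single i 1) ⬝ᵥ (S⁻¹ *ᵥ z) = z i := by
    rw [dotProduct_mulVec, ← mulVec_transpose, hPt, hPS]
    simp
  have key := hS.inv.posSemidef.dotProduct_mulVec_nonneg
    (z - (z i / S i i) • (S *ᵥ Pi.single i 1))
  simp only [star_trivial, mulVec_sub, mulVec_smul, hPS, sub_dotProduct, dotProduct_sub,
    smul_dotProduct, dotProduct_smul, hsymm, smul_eq_mul] at key
  have h3 : (S *ᵥ Pi.single i 1) ⬝ᵥ (Pi.single i 1) = S i i := by simp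
  have h4 : z ⬝ᵥ (Pi.single i 1) = z i := by simp
  rw [h3, h4] at key
  have : z i / S i i * (z i / S i i * S i i) = z i / S i i * z i := by
    field_simp
  have h5 : z i / S i i * z i ≤ z ⬝ᵥ S⁻¹ *ᵥ z := by linarith
  have h6 : z i ^ 2 = S i i * (z i / S i i * z i) := by field_simp
  rw [h6]
  gcongr

lemma exists_lower {n : Type} [Fintype n] [DecidableEq n] (S : Matrix n n ℝ) (hS : S.PosDef) :
    ∃ c > 0, ∀ z : n → ℝ, c * ∑ i, z i ^ 2 ≤ z ⬝ᵥ (S⁻¹ *ᵥ z) := by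
  have htr : 0 ≤ ∑ i, S i i := Finset.sum_nonneg fun i _ => (hS.diag_pos).le
  refine ⟨(∑ i, S i i + 1)⁻¹, by positivity, fun z => ?_⟩
  have hq : 0 ≤ z ⬝ᵥ (S⁻¹ *ᵥ z) := by
    simpa using hS.inv.posSemidef.dotProduct_mulVec_nonneg z
  have h1 : ∑ i, z i ^ 2 ≤ (∑ i, S i i) * (z ⬝ᵥ (S⁻¹ *ᵥ z)) := by
    rw [Finset.sum_mul]
    exact Finset.sum_le_sum fun i _ => coord_bound S hS z i
  rw [inv_mul_le_iff₀ (by positivity)]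
  nlinarith

lemma continuous_gaussD {n : Type} [Fintype n] [DecidableEq n] (S : Matrix n n ℝ) :
    Continuous (gaussD S 0) := by
  unfold gaussD
  simp only [dotProduct, mulVec]
  fun_prop

lemma gaussD_nonneg {n : Type} [Fintype n] [DecidableEq n] (S : Matrix n n ℝ) (m x : n → ℝ) :
    0 ≤ gaussD S m x := by
  unfold gaussD
  positivity

lemma exists_upper {n : Type} [Fintype n] [DecidableEq n] (S : Matrix n n ℝ) (hS : S.PosDef) :
    ∃ b > 0, ∃ C ≥ 0, ∀ z : n → ℝ, gaussD S 0 z ≤ C * ∏ i, Real.exp (-b * z i ^ 2) := by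
  obtain ⟨c, hc, h⟩ := exists_lower S hS
  refine ⟨c / 2, by positivity, (Real.sqrt ((2 * Real.pi) ^ (Fintype.card n) * S.det))⁻¹,
    by positivity, fun z => ?_⟩
  rw [← Real.exp_sum, ← Finset.mul_sum]
  unfold gaussD
  refine mul_le_mul_of_nonneg_left (Real.exp_le_exp.2 ?_) (by positivity)
  have := h z
  simp only [sub_zero]
  linarith

lemma integrable_gaussD {n : Type} [Fintype n] [DecidableEq n] (S : Matrix n n ℝ)
    (hS : S.PosDef) : Integrable (gaussD S 0) := by
  obtain ⟨b, hb, C, hC, h⟩ := exists_upper S hS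
  have := (Integrable.fintype_prod (μ := fun _ : n => (volume : Measure ℝ))
    (f := fun _ x => Real.exp (-b * x ^ 2)) (fun i => integrable_exp_neg_mul_sq hb)).const_mul C
  refine Integrable.mono' this (continuous_gaussD S).aestronglyMeasurable (ae_of_all _ fun z => ?_)
  rw [Real.norm_of_nonneg (gaussD_nonneg _ _ _)]
  exact h z

lemma integrable_coord {n : Type} [Fintype n] [DecidableEq n] (S : Matrix n n ℝ)
    (hS : S.PosDef) (i : n) : Integrable (fun z => gaussD S 0 z * z i) := by
  obtain ⟨b, hb, C, hC, h⟩ := exists_upper S hS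
  have := (Integrable.fintype_prod (μ := fun _ : n => (volume : Measure ℝ))
    (f := fun j x => (if j = i then x else 1) * Real.exp (-b * x ^ 2)) (fun j => by
      by_cases hj : j = i
      · simpa [hj] using integrable_mul_exp_neg_mul_sq hb
      · simpa [hj] using integrable_exp_neg_mul_sq hb)).norm.const_mul C
  refine Integrable.mono' this
    ((continuous_gaussD S).mul (continuous_apply i)).aestronglyMeasurable
    (ae_of_all _ fun z => ?_)
  rw [Finset.prod_mul_distrib, norm_mul, norm_mul, Real.norm_of_nonneg (gaussD_nonneg _ _ _)]
  simp only [Finset.prod_ite_eq', Finset.mem_univ, if_true]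
  rw [Real.norm_of_nonneg (Finset.prod_nonneg fun j _ => (Real.exp_pos _).le)]
  calc gaussD S 0 z * ‖z i‖ ≤ (C * ∏ i, Real.exp (-b * z i ^ 2)) * ‖z i‖ := by
        gcongr; exact h z
    _ = _ := by ring

lemma glueAt_eq {K : ℕ} (k : Fin K) (t : ℝ) (u : {j : Fin K // j ≠ k} → ℝ) :
    glueAt k t u = glueAt k 0 u + t • (Pi.single k 1 : Fin K → ℝ) := by
  funext i
  by_cases hi : i = k
  · subst hi; simp [glueAt]
  · simp [glueAt, hi]

lemma hasDeriv_gaussD {K : ℕ} (S : Matrix (Fin K) (Fin K) ℝ) (hS : S.PosDef) (k : Fin K)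
    (u : {j : Fin K // j ≠ k} → ℝ) (t : ℝ) :
    HasDerivAt (fun t => gaussD S 0 (glueAt k t u))
      (-(gaussD S 0 (glueAt k t u) * (S⁻¹ *ᵥ (glueAt k t u)) k)) t := by
  have hPt : S⁻¹ᵀ = S⁻¹ := by simpa using hS.inv.isHermitian.eq
  set w := glueAt k 0 u with hw
  set s : Fin K → ℝ := Pi.single k 1 with hs
  have h1 : s ⬝ᵥ (S⁻¹ *ᵥ w) = (S⁻¹ *ᵥ w) k := by simp [hs]
  have h2 : w ⬝ᵥ (S⁻¹ *ᵥ s) = (S⁻¹ *ᵥ w) k := by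
    rw [dotProduct_mulVec, ← mulVec_transpose, hPt]; simp [hs]
  have h3 : s ⬝ᵥ (S⁻¹ *ᵥ s) = (S⁻¹ *ᵥ s) k := by simp [hs]
  have hq : ∀ t, (glueAt k t u) ⬝ᵥ (S⁻¹ *ᵥ (glueAt k t u)) =
      w ⬝ᵥ (S⁻¹ *ᵥ w) + 2 * t * (S⁻¹ *ᵥ w) k + t ^ 2 * (S⁻¹ *ᵥ s) k := by
    intro t
    rw [glueAt_eq]
    simp only [← hw, ← hs, mulVec_add, mulVec_smul, add_dotProduct, dotProduct_add,
      smul_dotProduct, dotProduct_smul, smul_eq_mul, h1, h2, h3]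
    ring
  have hl : (S⁻¹ *ᵥ (glueAt k t u)) k = (S⁻¹ *ᵥ w) k + t * (S⁻¹ *ᵥ s) k := by
    rw [glueAt_eq]
    simp [← hw, ← hs, mulVec_add, mulVec_smul]
  simp only [gaussD, sub_zero, hq, hl]
  have hd : HasDerivAt (fun t : ℝ => -(1 / 2) * (w ⬝ᵥ (S⁻¹ *ᵥ w) + 2 * t * (S⁻¹ *ᵥ w) k
      + t ^ 2 * (S⁻¹ *ᵥ s) k)) (-(1/2) * (2 * 1 * (S⁻¹ *ᵥ w) k + (2 * t) * (S⁻¹ *ᵥ s) k)) t := by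
    refine HasDerivAt.const_mul _ (HasDerivAt.add (HasDerivAt.const_add _ ?_) ?_)
    · exact ((hasDerivAt_id t).const_mul 2).mul_const _
    · simpa using (hasDerivAt_pow 2 t).mul_const ((S⁻¹ *ᵥ s) k)
  refine (hd.exp.const_mul _).congr_deriv ?_
  ring

lemma det_schur {K : ℕ} (S : Matrix (Fin K) (Fin K) ℝ) (k : Fin K) (hk : S k k ≠ 0)
    (M : Matrix {j : Fin K // j ≠ k} {j : Fin K // j ≠ k} ℝ)
    (hM : ∀ j j', M j j' = S j.1 j'.1 - S j.1 k * (S k k)⁻¹ * S k j'.1) :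
    S.det = S k k * M.det := by
  let e : Unit ⊕ {j : Fin K // j ≠ k} ≃ Fin K :=
    (Equiv.sumCongr (Equiv.ofUnique Unit {j : Fin K // j = k})
      (Equiv.refl {j : Fin K // ¬ j = k})).trans (Equiv.sumCompl (fun j => j = k))
  rw [← det_submatrix_equiv_self e S]
  let A : Matrix Unit Unit ℝ := Matrix.of fun _ _ => S k k
  have hA : A.det = S k k := by simp [A]
  have : Invertible A := A.invertibleOfIsUnitDet (by rw [hA]; exact hk.isUnit)
  have hAi : ⅟A = Matrix.of fun _ _ => (S k k)⁻¹ := by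
    refine invOf_eq_right_inv ?_
    ext i j
    simp [A, mul_apply, hk]
  have hb : S.submatrix e e = fromBlocks A (Matrix.of fun _ j => S k j.1)
      (Matrix.of fun j _ => S j.1 k) (Matrix.of fun j j' => S j.1 j'.1) := by
    ext i j
    rcases i with i | i <;> rcases j with j | j <;> rfl
  rw [hb, det_fromBlocks₁₁, hA, hAi]
  congr 2
  ext i j
  simp [mul_apply, hM]

lemma quad_schur {K : ℕ} (S : Matrix (Fin K) (Fin K) ℝ) (hS : S.PosDef) (k : Fin K)
    (M : Matrix {j : Fin K // j ≠ k} {j : Fin K // j ≠ k} ℝ)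
    (hM : ∀ j j', M j j' = S j.1 j'.1 - S j.1 k * (S k k)⁻¹ * S k j'.1)
    (hMd : IsUnit M.det) (t : ℝ) (u w : {j : Fin K // j ≠ k} → ℝ)
    (hw : ∀ j, w j = u j - S j.1 k * (S k k)⁻¹ * t) :
    (glueAt k t u) ⬝ᵥ (S⁻¹ *ᵥ (glueAt k t u)) = t * (S k k)⁻¹ * t + w ⬝ᵥ (M⁻¹ *ᵥ w) := by
  have hdet : IsUnit S.det := hS.det_pos.ne'.isUnit
  have hii : S k k ≠ 0 := hS.diag_pos.ne'
  have hsym : ∀ i j, S i j = S j i := fun i j => by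
    simpa using (hS.isHermitian.apply i j).symm
  set v := M⁻¹ *ᵥ w with hv
  have hMv : M *ᵥ v = w := by
    rw [hv, mulVec_mulVec, mul_nonsing_inv _ hMd, one_mulVec]
  set B := ∑ j : {j : Fin K // j ≠ k}, S k j.1 * v j with hB
  set y := glueAt k ((S k k)⁻¹ * (t - B)) v with hy
  have hSy : S *ᵥ y = glueAt k t u := by
    funext i
    rw [mulVec, dotProduct, Fintype.sum_eq_add_sum_subtype_ne _ k]
    simp only [hy, glueAt_self, glueAt_ne]
    by_cases hi : i = k
    · subst hi
      rw [glueAt_self, ← hB]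
      field_simp
      ring
    · have h1 := glueAt_ne k t u ⟨i, hi⟩
      simp only at h1
      rw [h1]
      have h2 := congrFun hMv ⟨i, hi⟩
      rw [hw, mulVec, dotProduct] at h2
      simp only [hM, sub_mul, Finset.sum_sub_distrib] at h2
      have h3 : ∑ x : {j : Fin K // j ≠ k}, S i k * (S k k)⁻¹ * S k x.1 * v x =
          S i k * (S k k)⁻¹ * B := by
        rw [hB, Finset.mul_sum]
        exact Finset.sum_congr rfl fun _ _ => by ring
      rw [h3] at h2
      linear_combination h2
  have hy' : S⁻¹ *ᵥ (glueAt k t u) = y := by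
    rw [← hSy, mulVec_mulVec, nonsing_inv_mul _ hdet, one_mulVec]
  rw [hy', dotProduct, Fintype.sum_eq_add_sum_subtype_ne _ k]
  simp only [hy, glueAt_self, glueAt_ne, dotProduct, hw, sub_mul, Finset.sum_sub_distrib]
  have h3 : ∑ x : {j : Fin K // j ≠ k}, S x.1 k * (S k k)⁻¹ * t * v x =
      (S k k)⁻¹ * t * B := by
    rw [hB, Finset.mul_sum]
    exact Finset.sum_congr rfl fun x _ => by rw [hsym x.1 k]; ring
  rw [h3]
  ring

lemma gaussD_unit (U : Matrix Unit Unit ℝ) (s t : ℝ) (hU : ∀ i j, U i j = s) (hs : s ≠ 0) :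
    gaussD U 0 (fun _ => t) =
      (Real.sqrt (2 * Real.pi * s))⁻¹ * Real.exp (-(1 / 2) * (t * s⁻¹ * t)) := by
  have hinv : U⁻¹ = Matrix.of fun _ _ => s⁻¹ := by
    refine inv_eq_right_inv ?_
    ext i j
    simp [mul_apply, hs, hU]
  have hd : U.det = s := by simp [hU]
  unfold gaussD
  rw [hinv, hd, sub_zero]
  simp [dotProduct, mulVec, mul_assoc]

lemma gaussD_factor {K : ℕ} (S : Matrix (Fin K) (Fin K) ℝ) (hS : S.PosDef) (k : Fin K)
    (U : Matrix Unit Unit ℝ) (hU : ∀ i j, U i j = S k k)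
    (M : Matrix {j : Fin K // j ≠ k} {j : Fin K // j ≠ k} ℝ)
    (hM : ∀ j j', M j j' = S j.1 j'.1 - S j.1 k * (S k k)⁻¹ * S k j'.1)
    (t : ℝ) (m u : {j : Fin K // j ≠ k} → ℝ) (hm : ∀ j, m j = S j.1 k * (S k k)⁻¹ * t) :
    gaussD S 0 (glueAt k t u) = gaussD U 0 (fun _ => t) * gaussD M m u := by
  have hii : 0 < S k k := hS.diag_pos
  have hdet : S.det = S k k * M.det := det_schur S k hii.ne' M hM
  have hMpos : 0 < M.det := by
    have := hS.det_pos
    rw [hdet] at this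
    exact (mul_pos_iff_of_pos_left hii).1 this
  have hq := quad_schur S hS k M hM hMpos.ne'.isUnit t u
    (u - m) (fun j => by rw [Pi.sub_apply, hm])
  have hcard : Fintype.card (Fin K) = Fintype.card {j : Fin K // j ≠ k} + 1 := by
    have hK : 0 < K := k.pos
    have := Fintype.card_subtype_compl (fun j : Fin K => j = k)
    simp only [Fintype.card_fin, Fintype.card_subtype_eq] at this
    have h2 : Fintype.card {j : Fin K // j ≠ k} = K - 1 := by rw [← this]
    rw [h2, Fintype.card_fin]; omega
  rw [gaussD_unit U (S k k) t hU hii.ne']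
  unfold gaussD
  rw [sub_zero, hq, hdet, hcard, mul_add, Real.exp_add]
  have e2 : (2 * Real.pi) ^ (Fintype.card {j : Fin K // j ≠ k} + 1) * (S k k * M.det) =
    (2 * Real.pi * S k k) *
      ((2 * Real.pi) ^ (Fintype.card {j : Fin K // j ≠ k}) * M.det) := by
    rw [pow_succ]; ring
  rw [e2, Real.sqrt_mul (by positivity), mul_inv]
  ring

/-- Tallis's formula: the first moment of a centered Gaussian over the orthant-type region
`[a, ∞)` equals `Σ F(a)`, where the `k`-th entry of `F(a)` is the one-dimensional density at
`a_k` times the mass over `[a_{-k}, ∞)` of the conditional Gaussian on the remaining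
coordinates. -/
theorem truncated_gaussian_first_moment {K : ℕ}
    (Sg : Matrix (Fin K) (Fin K) ℝ) (hSg : Sg.PosDef) (a : Fin K → ℝ) :
    (∫ z in {z : Fin K → ℝ | ∀ k, a k ≤ z k}, gaussD Sg 0 z • z) =
      Sg *ᵥ (fun k =>
        gaussD (fun (_ _ : Unit) => Sg k k) 0 (fun _ => a k) *
          ∫ u in {u : {j : Fin K // j ≠ k} → ℝ | ∀ j, a j.1 ≤ u j},
            gaussD (fun j j' => Sg j.1 j'.1 - Sg j.1 k * (Sg k k)⁻¹ * Sg k j'.1)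
              (fun j => Sg j.1 k * (Sg k k)⁻¹ * a k) u) := by
  have hdet : IsUnit Sg.det := hSg.det_pos.ne'.isUnit
  set I := ∫ z in {z : Fin K → ℝ | ∀ k, a k ≤ z k}, gaussD Sg 0 z • z with hI
  suffices h : Sg⁻¹ *ᵥ I = (fun k =>
        gaussD (fun (_ _ : Unit) => Sg k k) 0 (fun _ => a k) *
          ∫ u in {u : {j : Fin K // j ≠ k} → ℝ | ∀ j, a j.1 ≤ u j},
            gaussD (fun j j' => Sg j.1 j'.1 - Sg j.1 k * (Sg k k)⁻¹ * Sg k j'.1)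
              (fun j => Sg j.1 k * (Sg k k)⁻¹ * a k) u) by
    rw [← h, mulVec_mulVec, mul_nonsing_inv _ hdet, one_mulVec]
  funext k
  have hIj : ∀ j, I j = ∫ z in {z : Fin K → ℝ | ∀ k, a k ≤ z k}, gaussD Sg 0 z * z j := by
    intro j
    rw [hI, eval_integral]
    · rfl
    · intro i
      exact (integrable_coord Sg hSg i).integrableOn
  have hsum : ∀ z : Fin K → ℝ, gaussD Sg 0 z * (Sg⁻¹ *ᵥ z) k =
      ∑ j, Sg⁻¹ k j * (gaussD Sg 0 z * z j) := by
    intro z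
    rw [mulVec, dotProduct, Finset.mul_sum]
    exact Finset.sum_congr rfl fun _ _ => by ring
  have hint : Integrable (fun z => gaussD Sg 0 z * (Sg⁻¹ *ᵥ z) k) := by
    simp only [hsum]
    exact integrable_finsetSum _ fun j _ => (integrable_coord Sg hSg j).const_mul _
  have h1 : (Sg⁻¹ *ᵥ I) k =
      ∫ z in {z : Fin K → ℝ | ∀ k, a k ≤ z k}, gaussD Sg 0 z * (Sg⁻¹ *ᵥ z) k := by
    simp only [hsum]
    rw [integral_finsetSum _
      fun j _ => ((integrable_coord Sg hSg j).const_mul _).integrableOn]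
    simp only [integral_const_mul, ← hIj]
    rfl
  have h2 := ibp k a _ _ (integrable_gaussD Sg hSg) hint.neg (hasDeriv_gaussD Sg hSg k)
  simp only [Pi.neg_apply, integral_neg, neg_inj] at h2
  rw [h1, h2, ← integral_const_mul]
  congr 1
  funext u
  exact gaussD_factor Sg hSg k _ (fun _ _ => rfl) _ (fun _ _ => rfl) _ _ _ (fun _ => rfl)
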